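/- arXiv:2309.13854 — 6 statements merged into one kernel-verified Lean document; each statement's English description precedes it below -/
import Mathlib

section
/- Let n ≥ 1 and let C be a set of N points on the unit sphere S^{n-1} ⊆ ℝ^n. Let q : (0,4] → ℝ be any function, and suppose f : [-1,1] → ℝ and f₀ ∈ ℝ satisfy f(t) ≤ q(2−2t) for all t ∈ [-1,1) and S_f(C) ≥ f₀·N². Then the potential energy E_q(C) := Σ_{(x,y)∈C², x≠y} q(‖x−y‖²) satisfies E_q(C) ≥ f₀·N² − N·f(1) (Yudin's energy bound). (Note that for unit vectors, ‖x−y‖² = 2 − 2 x·y.) -/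
open Finset RealInnerProductSpace

open scoped Classical in
/-- Yudin's lower bound for the potential energy of spherical configurations. -/
theorem yudin_energy_bound
    (n N : ℕ) (hn : 1 ≤ n)
    (C : Finset (EuclideanSpace ℝ (Fin n))) (hcard : C.card = N)
    (hunit : ∀ x ∈ C, ‖x‖ = 1)
    (q f : ℝ → ℝ) (f₀ : ℝ)
    (h1 : ∀ t ∈ Set.Ico (-1 : ℝ) 1, f t ≤ q (2 - 2 * t))
    (h2 : f₀ * (N : ℝ) ^ 2 ≤ ∑ x ∈ C, ∑ y ∈ C, f ⟪x, y⟫) :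
    f₀ * (N : ℝ) ^ 2 - (N : ℝ) * f 1 ≤
      ∑ x ∈ C, ∑ y ∈ C.erase x, q (‖x - y‖ ^ 2) := by
  have hpair : ∀ x ∈ C, ∀ y ∈ C.erase x, f ⟪x, y⟫ ≤ q (‖x - y‖ ^ 2) := by
    intro x hx y hy
    obtain ⟨hyx, hyC⟩ := Finset.mem_erase.mp hy
    have hx1 := hunit x hx
    have hy1 := hunit y hyC
    have hdist : ‖x - y‖ ^ 2 = 2 - 2 * ⟪x, y⟫ := by
      rw [norm_sub_sq_real, hx1, hy1]
      ring
    have hlower : -1 ≤ ⟪x, y⟫ := by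
      simpa [hx1, hy1] using neg_le_of_abs_le (abs_real_inner_le_norm x y)
    have hupper : ⟪x, y⟫ < 1 :=
      (inner_lt_one_iff_real_of_norm_eq_one hx1 hy1).mpr hyx.symm
    rw [hdist]
    exact h1 _ ⟨hlower, hupper⟩
  have hsplit : ∑ x ∈ C, ∑ y ∈ C, f ⟪x, y⟫ =
      (N : ℝ) * f 1 + ∑ x ∈ C, ∑ y ∈ C.erase x, f ⟪x, y⟫ := by
    rw [← hcard, ← nsmul_eq_mul, ← Finset.sum_const, ← Finset.sum_add_distrib]
    refine Finset.sum_congr rfl fun x hx => ?_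
    rw [← Finset.add_sum_erase C _ hx, real_inner_self_eq_norm_sq, hunit x hx, one_pow]
  have hsum := Finset.sum_le_sum fun x hx => Finset.sum_le_sum (hpair x hx)
  linarith
end

section
/- Let n ≥ 1, let T ⊆ [-1,1), let C be an (N,n,T) spherical code, and let F : [-1,1]³ → ℝ be a symmetric function. Suppose f : T → ℝ and g : T → ℝ are such that (1) F(1,t,t) ≤ f(t) for all t ∈ T, and (2) F(t,u,v) ≤ g(t) + g(u) + g(v) for all (t,u,v) ∈ D₃(T). If S_F(C) ≥ F₀·N³ for some F₀ ∈ ℝ, then N·F(1,1,1) + 3·E_f(C) + (3N−6)·E_g(C) ≥ F₀·N³. -/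
open Finset RealInnerProductSpace

/-- The Gram determinant of three unit vectors is nonnegative. -/
theorem gram_det_three_nonneg {E : Type*} [NormedAddCommGroup E] [InnerProductSpace ℝ E]
    {x y z : E} (hx : ‖x‖ = 1) (hy : ‖y‖ = 1) (hz : ‖z‖ = 1) :
    0 ≤ 1 + 2 * ⟪x, y⟫ * ⟪x, z⟫ * ⟪y, z⟫ - ⟪x, y⟫ ^ 2 - ⟪x, z⟫ ^ 2 - ⟪y, z⟫ ^ 2 := by
  have h := real_inner_mul_inner_self_le (y - ⟪x, y⟫ • x) (z - ⟪x, z⟫ • x)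
  simp only [inner_sub_left, inner_sub_right, real_inner_smul_left, real_inner_smul_right,
    inner_self_eq_one_of_norm_eq_one hx, inner_self_eq_one_of_norm_eq_one hy,
    inner_self_eq_one_of_norm_eq_one hz, real_inner_comm x y, real_inner_comm x z] at h
  nlinarith [h]

/-- Averaging a constant over the points of `C` distinct from two given points of `C`. -/
theorem sum_mul_one_sub_ite_sub_ite {α : Type*} [DecidableEq α] {C : Finset α} {x y : α}
    (hx : x ∈ C) (hy : y ∈ C) (c : ℝ) :
    ∑ z ∈ C, c * (1 - (if z = x then 1 else 0) - (if z = y then 1 else 0)) =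
      ((C.card : ℝ) - 2) * c := by
  rw [← Finset.mul_sum, Finset.sum_sub_distrib, Finset.sum_sub_distrib,
    Finset.sum_ite_eq' C x, Finset.sum_ite_eq' C y, if_pos hx, if_pos hy]
  simp only [Finset.sum_const, nsmul_eq_mul, mul_one]
  ring

/-- Summing over pairs of distinct points as a sum over all pairs with zero diagonal. -/
theorem sum_erase_eq_sum_ite {α : Type*} [DecidableEq α] (C : Finset α) (x : α) (φ : α → ℝ) :
    ∑ y ∈ C.erase x, φ y = ∑ y ∈ C, if x = y then 0 else φ y := by
  rw [← Finset.filter_ne C x, Finset.sum_filter]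
  exact Finset.sum_congr rfl fun y _ => by by_cases h : x = y <;> simp [h]

open scoped Classical in
/-- General 3-point bound for spherical codes (Theorem th3p). -/
theorem general_three_point_bound
    (n N : ℕ) (hn : 1 ≤ n) (T : Set ℝ) (hTsub : T ⊆ Set.Ico (-1 : ℝ) 1)
    (C : Finset (EuclideanSpace ℝ (Fin n))) (hcard : C.card = N)
    (hunit : ∀ x ∈ C, ‖x‖ = 1)
    (hcode : ∀ x ∈ C, ∀ y ∈ C, x ≠ y → ⟪x, y⟫ ∈ T)
    (F : ℝ → ℝ → ℝ → ℝ)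
    (hsym1 : ∀ a b c : ℝ, F a b c = F b a c)
    (hsym2 : ∀ a b c : ℝ, F a b c = F a c b)
    (f g : ℝ → ℝ) (F₀ : ℝ)
    (h1 : ∀ t ∈ T, F 1 t t ≤ f t)
    (h2 : ∀ t ∈ T, ∀ u ∈ T, ∀ v ∈ T,
      0 ≤ 1 + 2 * t * u * v - t ^ 2 - u ^ 2 - v ^ 2 →
        F t u v ≤ g t + g u + g v)
    (hSF : F₀ * (N : ℝ) ^ 3 ≤ ∑ x ∈ C, ∑ y ∈ C, ∑ z ∈ C, F ⟪x, y⟫ ⟪x, z⟫ ⟪y, z⟫) :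
    F₀ * (N : ℝ) ^ 3 ≤
      (N : ℝ) * F 1 1 1
        + 3 * ∑ x ∈ C, ∑ y ∈ C.erase x, f ⟪x, y⟫
        + (3 * (N : ℝ) - 6) * ∑ x ∈ C, ∑ y ∈ C.erase x, g ⟪x, y⟫ := by
  set G : EuclideanSpace ℝ (Fin n) → EuclideanSpace ℝ (Fin n) → ℝ :=
    fun x y => if x = y then 0 else g ⟪x, y⟫ with hG
  set P : EuclideanSpace ℝ (Fin n) → EuclideanSpace ℝ (Fin n) → ℝ :=
    fun x y => if x = y then 0 else f ⟪x, y⟫ with hP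
  have hEf : ∑ x ∈ C, ∑ y ∈ C.erase x, f ⟪x, y⟫ = ∑ x ∈ C, ∑ y ∈ C, P x y :=
    Finset.sum_congr rfl fun x _ => sum_erase_eq_sum_ite C x _
  have hEg : ∑ x ∈ C, ∑ y ∈ C.erase x, g ⟪x, y⟫ = ∑ x ∈ C, ∑ y ∈ C, G x y :=
    Finset.sum_congr rfl fun x _ => sum_erase_eq_sum_ite C x _
  have hself : ∀ x ∈ C, ⟪x, x⟫ = (1 : ℝ) := fun x hx => by
    rw [real_inner_self_eq_norm_sq, hunit x hx, one_pow]
  have key : ∀ x ∈ C, ∀ y ∈ C, ∀ z ∈ C, F ⟪x, y⟫ ⟪x, z⟫ ⟪y, z⟫ ≤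
      (if x = y then (if x = z then F 1 1 1 else 0) else 0)
        + (if x = y then P x z else 0) + (if x = z then P x y else 0)
        + (if y = z then P x y else 0)
        + G x y * (1 - (if z = x then 1 else 0) - (if z = y then 1 else 0))
        + G x z * (1 - (if y = x then 1 else 0) - (if y = z then 1 else 0))
        + G y z * (1 - (if x = y then 1 else 0) - (if x = z then 1 else 0)) := by
    intro x hx y hy z hz
    by_cases hxy : x = y
    · subst hxy
      by_cases hxz : x = z
      · subst hxz
        simp [hG, hP, hunit x hx]
      · have := h1 _ (hcode x hx z hz hxz)
        simpa [hG, hP, hxz, Ne.symm hxz, hunit x hx] using this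
    · by_cases hxz : x = z
      · subst hxz
        have := h1 _ (hcode x hx y hy hxy)
        rw [hself x hx, hsym2, real_inner_comm x y, hsym2, hsym1]
        simpa [hG, hP, hxy, Ne.symm hxy] using this
      · by_cases hyz : y = z
        · subst hyz
          have := h1 _ (hcode x hx y hy hxy)
          rw [hself y hy, hsym2, hsym1]
          simpa [hG, hP, hxy, Ne.symm hxy] using this
        · have := h2 _ (hcode x hx y hy hxy) _ (hcode x hx z hz hxz) _ (hcode y hy z hz hyz)
            (gram_det_three_nonneg (hunit x hx) (hunit y hy) (hunit z hz))
          simpa [hG, hP, hxy, hxz, hyz, Ne.symm hxy, Ne.symm hxz, Ne.symm hyz] using this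
  refine hSF.trans ((Finset.sum_le_sum fun x hx => Finset.sum_le_sum fun y hy =>
    Finset.sum_le_sum fun z hz => key x hx y hy z hz).trans (le_of_eq ?_))
  simp only [Finset.sum_add_distrib]
  have e1 : ∑ x ∈ C, ∑ y ∈ C, ∑ z ∈ C,
      (if x = y then (if x = z then F 1 1 1 else 0) else 0) = (N : ℝ) * F 1 1 1 := by
    rw [← hcard, ← nsmul_eq_mul, ← Finset.sum_const]
    refine Finset.sum_congr rfl fun x hx => ?_
    rw [Finset.sum_comm]
    simp [hx]
  have e2 : ∑ x ∈ C, ∑ y ∈ C, ∑ z ∈ C, (if x = y then P x z else 0) =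
      ∑ x ∈ C, ∑ y ∈ C, P x y := by
    refine Finset.sum_congr rfl fun x hx => ?_
    rw [Finset.sum_comm]
    exact Finset.sum_congr rfl fun z _ => by rw [Finset.sum_ite_eq, if_pos hx]
  have e3 : ∑ x ∈ C, ∑ y ∈ C, ∑ z ∈ C, (if x = z then P x y else 0) =
      ∑ x ∈ C, ∑ y ∈ C, P x y :=
    Finset.sum_congr rfl fun x hx => Finset.sum_congr rfl fun y _ => by
      rw [Finset.sum_ite_eq, if_pos hx]
  have e4 : ∑ x ∈ C, ∑ y ∈ C, ∑ z ∈ C, (if y = z then P x y else 0) =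
      ∑ x ∈ C, ∑ y ∈ C, P x y :=
    Finset.sum_congr rfl fun x _ => Finset.sum_congr rfl fun y hy => by
      rw [Finset.sum_ite_eq, if_pos hy]
  have e5 : ∑ x ∈ C, ∑ y ∈ C, ∑ z ∈ C,
      G x y * (1 - (if z = x then 1 else 0) - (if z = y then 1 else 0)) =
      ((N : ℝ) - 2) * ∑ x ∈ C, ∑ y ∈ C, G x y := by
    simp only [Finset.mul_sum]
    exact Finset.sum_congr rfl fun x hx => Finset.sum_congr rfl fun y hy => by
      rw [sum_mul_one_sub_ite_sub_ite hx hy, hcard]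
  have e6 : ∑ x ∈ C, ∑ y ∈ C, ∑ z ∈ C,
      G x z * (1 - (if y = x then 1 else 0) - (if y = z then 1 else 0)) =
      ((N : ℝ) - 2) * ∑ x ∈ C, ∑ y ∈ C, G x y := by
    rw [← e5]
    exact Finset.sum_congr rfl fun x _ => Finset.sum_comm
  have e7 : ∑ x ∈ C, ∑ y ∈ C, ∑ z ∈ C,
      G y z * (1 - (if x = y then 1 else 0) - (if x = z then 1 else 0)) =
      ((N : ℝ) - 2) * ∑ x ∈ C, ∑ y ∈ C, G x y := by
    rw [← e5, Finset.sum_comm]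
    exact Finset.sum_congr rfl fun y _ => Finset.sum_comm
  rw [e1, e2, e3, e4, e5, e6, e7, hEf, hEg]
  ring
end

section
/- Let n ≥ 1, let T ⊆ [-1,1), let C be a nonempty (N,n,T) spherical code, and let F : [-1,1]³ → ℝ be a symmetric function. Suppose g : T → ℝ, q : [-1,1] → ℝ and B ∈ ℝ are such that (1) F(1,t,t) ≤ B + 2g(t) − q(t) for all t ∈ T, and (2) F(t,u,v) ≤ g(t) + g(u) + g(v) for all (t,u,v) ∈ D₃(T). If S_F(C) ≥ F₀·N³ for some F₀ ∈ ℝ and S_q(C) ≥ 0, then F(1,1,1) + 3q(1) + 3(N−1)·B + 3·E_g(C) ≥ F₀·N². -/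
open Finset RealInnerProductSpace

/-- The Gram determinant of three unit vectors is nonnegative. -/
theorem gram_det_nonneg_of_unit {E : Type*} [NormedAddCommGroup E] [InnerProductSpace ℝ E]
    {x y z : E} (hx : ‖x‖ = 1) (hy : ‖y‖ = 1) (hz : ‖z‖ = 1) :
    0 ≤ 1 + 2 * inner ℝ x y * inner ℝ x z * inner ℝ y z
      - inner ℝ x y ^ 2 - inner ℝ x z ^ 2 - inner ℝ y z ^ 2 := by
  have h := real_inner_mul_inner_self_le (y - inner ℝ x y • x) (z - inner ℝ x z • x)
  simp only [inner_sub_left, inner_sub_right, real_inner_smul_left, real_inner_smul_right,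
    real_inner_self_eq_norm_sq, norm_smul, mul_pow, Real.norm_eq_abs, sq_abs, hx, hy, hz,
    real_inner_comm x y, real_inner_comm x z] at h
  linarith

/-- Summing the pointwise majorant of a three-point function over all triples. -/
theorem sum_three_point_majorant {α : Type*} [DecidableEq α] (C : Finset α) (G Q : α → α → ℝ)
    (B c : ℝ) :
    ∑ x ∈ C, ∑ y ∈ C, ∑ z ∈ C,
      (G x y + G x z + G y z + (if x = y then B - Q x z else 0)
        + (if x = z then B - Q x y else 0) + (if y = z then B - Q x y else 0)
        + (if x = y then if y = z then c else 0 else 0)) =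
      3 * C.card * ∑ x ∈ C, ∑ y ∈ C, G x y
        + 3 * ((C.card : ℝ) ^ 2 * B - ∑ x ∈ C, ∑ y ∈ C, Q x y) + C.card * c := by
  have e (x : α) (f : α → ℝ) : ∑ y ∈ C, ∑ z ∈ C, (if x = y then f z else 0) =
      if x ∈ C then ∑ z ∈ C, f z else 0 := by
    rw [Finset.sum_comm]
    simp only [Finset.sum_ite_eq]
    split_ifs <;> simp
  have hQ : ∑ x ∈ C, ∑ y ∈ C, (B - Q x y) =
      (C.card : ℝ) ^ 2 * B - ∑ x ∈ C, ∑ y ∈ C, Q x y := by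
    simp only [Finset.sum_sub_distrib, Finset.sum_const, nsmul_eq_mul]
    ring
  have hd (f : α → α → ℝ) : ∑ x ∈ C, (if x ∈ C then ∑ z ∈ C, f x z else 0) =
      ∑ x ∈ C, ∑ z ∈ C, f x z :=
    Finset.sum_congr rfl fun x hx => if_pos hx
  have h1 : ∑ x ∈ C, ∑ y ∈ C, ∑ z ∈ C, (if x = y then B - Q x z else 0) =
      ∑ x ∈ C, ∑ y ∈ C, (B - Q x y) := by
    simp only [e, hd]
  have h2 : ∑ x ∈ C, ∑ y ∈ C, ∑ z ∈ C, (if x = z then B - Q x y else 0) =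
      ∑ x ∈ C, ∑ y ∈ C, (B - Q x y) :=
    Finset.sum_congr rfl fun x hx => Finset.sum_congr rfl fun y _ => by simp [hx]
  have h3 : ∑ x ∈ C, ∑ y ∈ C, ∑ z ∈ C, (if y = z then B - Q x y else 0) =
      ∑ x ∈ C, ∑ y ∈ C, (B - Q x y) :=
    Finset.sum_congr rfl fun x _ => Finset.sum_congr rfl fun y hy => by simp [hy]
  have h4 : ∑ x ∈ C, ∑ y ∈ C, ∑ z ∈ C, (if x = y then if y = z then c else 0 else 0) =
      C.card * c := by
    rw [← nsmul_eq_mul, ← Finset.sum_const]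
    refine Finset.sum_congr rfl fun x hx => ?_
    rw [Finset.sum_eq_single_of_mem x hx fun y _ hy => by simp [hy.symm]]
    simp [hx]
  simp only [Finset.sum_add_distrib, h1, h2, h3, h4, hQ]
  simp only [Finset.sum_const, nsmul_eq_mul, ← Finset.mul_sum]
  ring

open scoped Classical in
/-- Corollary cor22: 3-point bound with `f(t) = B + 2g(t) - q(t)` and `S_q(C) ≥ 0`. -/
theorem three_point_bound_cor22
    (n N : ℕ) (hn : 1 ≤ n) (T : Set ℝ) (hTsub : T ⊆ Set.Ico (-1 : ℝ) 1)
    (C : Finset (EuclideanSpace ℝ (Fin n))) (hcard : C.card = N)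
    (hCne : C.Nonempty)
    (hunit : ∀ x ∈ C, ‖x‖ = 1)
    (hcode : ∀ x ∈ C, ∀ y ∈ C, x ≠ y → ⟪x, y⟫ ∈ T)
    (F : ℝ → ℝ → ℝ → ℝ)
    (hsym1 : ∀ a b c : ℝ, F a b c = F b a c)
    (hsym2 : ∀ a b c : ℝ, F a b c = F a c b)
    (g q : ℝ → ℝ) (B F₀ : ℝ)
    (h1 : ∀ t ∈ T, F 1 t t ≤ B + 2 * g t - q t)
    (h2 : ∀ t ∈ T, ∀ u ∈ T, ∀ v ∈ T,
      0 ≤ 1 + 2 * t * u * v - t ^ 2 - u ^ 2 - v ^ 2 →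
        F t u v ≤ g t + g u + g v)
    (hSF : F₀ * (N : ℝ) ^ 3 ≤ ∑ x ∈ C, ∑ y ∈ C, ∑ z ∈ C, F ⟪x, y⟫ ⟪x, z⟫ ⟪y, z⟫)
    (hSq : 0 ≤ ∑ x ∈ C, ∑ y ∈ C, q ⟪x, y⟫) :
    F₀ * (N : ℝ) ^ 2 ≤
      F 1 1 1 + 3 * q 1 + 3 * ((N : ℝ) - 1) * B
        + 3 * ∑ x ∈ C, ∑ y ∈ C.erase x, g ⟪x, y⟫ := by
  have hself : ∀ x ∈ C, ⟪x, x⟫ = 1 := fun x hx => by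
    rw [real_inner_self_eq_norm_sq, hunit x hx, one_pow]
  set G : EuclideanSpace ℝ (Fin n) → EuclideanSpace ℝ (Fin n) → ℝ :=
    fun x y => if x = y then 0 else g ⟪x, y⟫ with hG
  have hE : ∑ x ∈ C, ∑ y ∈ C.erase x, g ⟪x, y⟫ = ∑ x ∈ C, ∑ y ∈ C, G x y :=
    Finset.sum_congr rfl fun x hx => by
      rw [← Finset.add_sum_erase C (G x) hx]
      simp only [hG, if_true, zero_add]
      exact Finset.sum_congr rfl fun y hy => (if_neg (Finset.ne_of_mem_erase hy).symm).symm
  have hpt : ∀ x ∈ C, ∀ y ∈ C, ∀ z ∈ C, F ⟪x, y⟫ ⟪x, z⟫ ⟪y, z⟫ ≤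
      G x y + G x z + G y z + (if x = y then B - q ⟪x, z⟫ else 0)
        + (if x = z then B - q ⟪x, y⟫ else 0) + (if y = z then B - q ⟪x, y⟫ else 0)
        + (if x = y then if y = z then F 1 1 1 - 3 * B + 3 * q 1 else 0 else 0) := by
    intro x hx y hy z hz
    by_cases hxy : x = y
    · subst hxy
      by_cases hxz : x = z
      · subst hxz
        simp only [hG, hself x hx, if_true]
        linarith
      · simp only [hG, hself x hx, if_true, if_neg hxz]
        linarith [h1 _ (hcode x hx z hz hxz)]
    · by_cases hxz : x = z
      · subst hxz
        have hyx : y ≠ x := Ne.symm hxy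
        simp only [hG, hself x hx, if_true, if_neg hxy, if_neg hyx, real_inner_comm x y]
        rw [hsym1]
        linarith [h1 _ (hcode x hx y hy hxy), real_inner_comm x y]
      · by_cases hyz : y = z
        · subst hyz
          simp only [hG, hself y hy, if_true, if_neg hxy]
          rw [hsym2, hsym1]
          linarith [h1 _ (hcode x hx y hy hxy)]
        · simp only [hG, if_neg hxy, if_neg hxz, if_neg hyz]
          linarith [h2 _ (hcode x hx y hy hxy) _ (hcode x hx z hz hxz) _ (hcode y hy z hz hyz)
            (gram_det_nonneg_of_unit (hunit x hx) (hunit y hy) (hunit z hz))]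
  have hsum := hSF.trans <| Finset.sum_le_sum fun x hx => Finset.sum_le_sum fun y hy =>
    Finset.sum_le_sum fun z hz => hpt x hx y hy z hz
  rw [sum_three_point_majorant C G (fun x y => q ⟪x, y⟫), hcard] at hsum
  have hN : (0 : ℝ) < N := by
    rw [← hcard]
    exact_mod_cast hCne.card_pos
  rw [hE]
  refine le_of_mul_le_mul_left ?_ hN
  linarith
end

section
/- Let n ≥ 1, let T ⊆ [-1,1), let C be an (N,n,T) spherical code with N ≥ 2, and let F : [-1,1]³ → ℝ be a symmetric function. Suppose h : T → ℝ, g : T → ℝ and h₀ ≥ 0 are such that (1) h(t) + h₀ + F(1,t,t) ≤ 2g(t) for all t ∈ T, and (2) F(t,u,v) ≤ g(t) + g(u) + g(v) for all (t,u,v) ∈ D₃(T). If S_F(C) ≥ F₀·N³ for some F₀ ∈ ℝ, then R_g(C) ≥ (1/3)·F₀·N + (1/3)·h₀ − F(1,1,1)/(3N) + E_h(C)/N². -/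
open Finset RealInnerProductSpace

theorem sum_sum_erase_eq_sum_sum_ite {α : Type*} [DecidableEq α] (C : Finset α)
    (p : α → α → ℝ) :
    ∑ x ∈ C, ∑ y ∈ C.erase x, p x y = ∑ x ∈ C, ∑ y ∈ C, if x = y then 0 else p x y := by
  refine Finset.sum_congr rfl fun x hx => ?_
  rw [← Finset.add_sum_erase C _ hx, if_pos rfl, zero_add]
  exact Finset.sum_congr rfl fun y hy => (if_neg (Finset.ne_of_mem_erase hy).symm).symm

theorem sum_sum_erase_const {α : Type*} [DecidableEq α] (C : Finset α) (c : ℝ) :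
    ∑ x ∈ C, ∑ _y ∈ C.erase x, c = (C.card : ℝ) * ((C.card : ℝ) - 1) * c := by
  rw [Finset.sum_congr rfl fun x hx => by
    rw [Finset.sum_const, nsmul_eq_mul, Finset.cast_card_erase_of_mem hx]]
  rw [Finset.sum_const, nsmul_eq_mul, mul_assoc]

/-- A triple sum is bounded by sums over pairs as soon as its terms are bounded according to the
coincidences among the three indices. -/
theorem sum_triple_le {α : Type*} [DecidableEq α] (C : Finset α)
    (Φ : α → α → α → ℝ) (p q : α → α → ℝ) (d : ℝ)
    (hdiag : ∀ x ∈ C, Φ x x x ≤ d)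
    (hxy : ∀ x ∈ C, ∀ z ∈ C, x ≠ z → Φ x x z ≤ 2 * p x z - q x z)
    (hxz : ∀ x ∈ C, ∀ y ∈ C, x ≠ y → Φ x y x ≤ p x y + p y x - q x y)
    (hyz : ∀ x ∈ C, ∀ y ∈ C, x ≠ y → Φ x y y ≤ 2 * p x y - q x y)
    (hdist : ∀ x ∈ C, ∀ y ∈ C, ∀ z ∈ C, x ≠ y → x ≠ z → y ≠ z →
      Φ x y z ≤ p x y + p x z + p y z) :
    ∑ x ∈ C, ∑ y ∈ C, ∑ z ∈ C, Φ x y z ≤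
      (C.card : ℝ) * d + 3 * (C.card : ℝ) * (∑ x ∈ C, ∑ y ∈ C.erase x, p x y)
        - 3 * ∑ x ∈ C, ∑ y ∈ C.erase x, q x y := by
  rw [sum_sum_erase_eq_sum_sum_ite, sum_sum_erase_eq_sum_sum_ite]
  set P : α → α → ℝ := fun x y => if x = y then 0 else p x y with hP
  set Q : α → α → ℝ := fun x y => if x = y then 0 else q x y with hQ
  have hpt : ∀ x ∈ C, ∀ y ∈ C, ∀ z ∈ C, Φ x y z ≤
      P x y + P x z + P y z - (if x = y then Q x z else 0) - (if x = z then Q x y else 0)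
        - (if y = z then Q x y else 0) + (if x = y then (if x = z then d else 0) else 0) := by
    intro x hx y hy z hz
    by_cases exy : x = y
    · subst exy
      by_cases exz : x = z
      · subst exz
        simpa [hP, hQ] using hdiag x hx
      · have := hxy x hx z hz exz
        simp only [hP, hQ, exz, if_true, if_false]
        linarith
    · by_cases exz : x = z
      · subst exz
        have := hxz x hx y hy exy
        simp only [hP, hQ, exy, Ne.symm exy, if_true, if_false]
        linarith
      · by_cases eyz : y = z
        · subst eyz
          have := hyz x hx y hy exy
          simp only [hP, hQ, exy, if_true, if_false]
          linarith
        · have := hdist x hx y hy z hz exy exz eyz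
          simp only [hP, hQ, exy, exz, eyz, if_false]
          linarith
  refine (Finset.sum_le_sum fun x hx => Finset.sum_le_sum fun y hy =>
    Finset.sum_le_sum fun z hz => hpt x hx y hy z hz).trans (le_of_eq ?_)
  have e1 : ∑ x ∈ C, ∑ y ∈ C, ∑ z ∈ C, (if x = y then Q x z else 0)
      = ∑ x ∈ C, ∑ y ∈ C, Q x y := by
    refine Finset.sum_congr rfl fun x hx => ?_
    rw [Finset.sum_comm]
    exact Finset.sum_congr rfl fun z _ => by rw [Finset.sum_ite_eq, if_pos hx]
  have e2 : ∑ x ∈ C, ∑ y ∈ C, ∑ z ∈ C, (if x = z then Q x y else 0)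
      = ∑ x ∈ C, ∑ y ∈ C, Q x y :=
    Finset.sum_congr rfl fun x hx => Finset.sum_congr rfl fun y _ => by
      rw [Finset.sum_ite_eq, if_pos hx]
  have e3 : ∑ x ∈ C, ∑ y ∈ C, ∑ z ∈ C, (if y = z then Q x y else 0)
      = ∑ x ∈ C, ∑ y ∈ C, Q x y :=
    Finset.sum_congr rfl fun x _ => Finset.sum_congr rfl fun y hy => by
      rw [Finset.sum_ite_eq, if_pos hy]
  have e4 : ∑ x ∈ C, ∑ y ∈ C, ∑ z ∈ C, (if x = y then (if x = z then d else 0) else 0)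
      = (C.card : ℝ) * d := by
    rw [← nsmul_eq_mul, ← Finset.sum_const]
    refine Finset.sum_congr rfl fun x hx => ?_
    rw [Finset.sum_comm]
    simp [hx]
  simp only [Finset.sum_add_distrib, Finset.sum_sub_distrib, e1, e2, e3, e4, Finset.sum_const,
    nsmul_eq_mul, ← Finset.mul_sum]
  ring

open scoped Classical in
/-- Theorem thDD: the 3-point SDP bound for the distance distribution of
spherical codes, stated in terms of `R_g(C) = E_g(C)/N`. -/
theorem distance_distribution_bound
    (n N : ℕ) (hn : 1 ≤ n) (hN : 2 ≤ N)
    (T : Set ℝ) (hTsub : T ⊆ Set.Ico (-1 : ℝ) 1)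
    (C : Finset (EuclideanSpace ℝ (Fin n))) (hcard : C.card = N)
    (hunit : ∀ x ∈ C, ‖x‖ = 1)
    (hcode : ∀ x ∈ C, ∀ y ∈ C, x ≠ y → ⟪x, y⟫ ∈ T)
    (F : ℝ → ℝ → ℝ → ℝ)
    (hsym1 : ∀ a b c : ℝ, F a b c = F b a c)
    (hsym2 : ∀ a b c : ℝ, F a b c = F a c b)
    (h g : ℝ → ℝ) (h₀ F₀ : ℝ) (hh₀ : 0 ≤ h₀)
    (h1 : ∀ t ∈ T, h t + h₀ + F 1 t t ≤ 2 * g t)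
    (h2 : ∀ t ∈ T, ∀ u ∈ T, ∀ v ∈ T,
      0 ≤ 1 + 2 * t * u * v - t ^ 2 - u ^ 2 - v ^ 2 →
        F t u v ≤ g t + g u + g v)
    (hSF : F₀ * (N : ℝ) ^ 3 ≤ ∑ x ∈ C, ∑ y ∈ C, ∑ z ∈ C, F ⟪x, y⟫ ⟪x, z⟫ ⟪y, z⟫) :
    (1 / 3) * F₀ * (N : ℝ) + (1 / 3) * h₀ - F 1 1 1 / (3 * (N : ℝ))
        + (∑ x ∈ C, ∑ y ∈ C.erase x, h ⟪x, y⟫) / (N : ℝ) ^ 2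
      ≤ (∑ x ∈ C, ∑ y ∈ C.erase x, g ⟪x, y⟫) / (N : ℝ) := by
  have hself : ∀ x ∈ C, ⟪x, x⟫ = 1 := fun x hx => by
    rw [real_inner_self_eq_norm_sq, hunit x hx, one_pow]
  have key := sum_triple_le C (fun x y z => F ⟪x, y⟫ ⟪x, z⟫ ⟪y, z⟫)
    (fun x y => g ⟪x, y⟫) (fun x y => h ⟪x, y⟫ + h₀) (F 1 1 1)
    (fun x hx => by simp only [hself x hx, le_refl])
    (fun x hx z hz hne => by
      have := h1 _ (hcode x hx z hz hne)
      simp only [hself x hx]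
      linarith)
    (fun x hx y hy hne => by
      have := h1 _ (hcode x hx y hy hne)
      simp only [hself x hx, real_inner_comm x y]
      rw [hsym1]
      linarith)
    (fun x hx y hy hne => by
      have := h1 _ (hcode x hx y hy hne)
      simp only [hself y hy]
      rw [hsym2, hsym1]
      linarith)
    (fun x hx y hy z hz hxy hxz hyz =>
      h2 _ (hcode x hx y hy hxy) _ (hcode x hx z hz hxz) _ (hcode y hy z hz hyz)
        (gram_det_three_nonneg (hunit x hx) (hunit y hy) (hunit z hz)))
  simp only [Finset.sum_add_distrib,
    sum_sum_erase_const, hcard] at key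
  have hN' : (2 : ℝ) ≤ N := by exact_mod_cast hN
  have hNpos : (0 : ℝ) < N := by linarith
  have hbound := hSF.trans key
  set Eg := ∑ x ∈ C, ∑ y ∈ C.erase x, g ⟪x, y⟫
  set Eh := ∑ x ∈ C, ∑ y ∈ C.erase x, h ⟪x, y⟫
  have hh : 0 ≤ h₀ * ((N : ℝ) * (2 * N - 3)) :=
    mul_nonneg hh₀ (mul_nonneg hNpos.le (by linarith))
  rw [← sub_nonneg]
  have hid : Eg / (N : ℝ) - ((1 / 3) * F₀ * (N : ℝ) + (1 / 3) * h₀ - F 1 1 1 / (3 * (N : ℝ))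
      + Eh / (N : ℝ) ^ 2)
      = (3 * N * Eg - F₀ * (N : ℝ) ^ 3 - h₀ * (N : ℝ) ^ 2 + N * F 1 1 1 - 3 * Eh)
        / (3 * (N : ℝ) ^ 2) := by
    field_simp
    ring
  rw [hid]
  exact div_nonneg (by nlinarith) (by positivity)
end

section
/- Let C be a (24,4,π/3) spherical code, i.e., a set of 24 unit vectors in ℝ⁴ with x·y ≤ 1/2 for all distinct x,y ∈ C. Then A([-1,0.05]) ≤ 15; that is, the number of ordered pairs (x,y) of distinct points of C with x·y ∈ [-1,0.05] is at most 15·24 = 360. -/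
open Finset RealInnerProductSpace

/-- The coefficient of `X ^ j * Y ^ (k - j)` in `(a * X + b * Y) ^ i * (c * X + d * Y) ^ (k - i)`,
that is, a matrix entry of the `k`-th symmetric power of `!![a, b; c, d]`. -/
def symPowEntry {R : Type*} [CommSemiring R] (k i j : ℕ) (a b c d : R) : R :=
  ∑ s ∈ range (i + 1), if s ≤ j ∧ j - s ≤ k - i then
    (i.choose s : R) * ((k - i).choose (j - s) : R) *
      (a ^ s * b ^ (i - s) * c ^ (j - s) * d ^ (k - i - (j - s))) else 0

theorem chebyshevU_three (R : Type*) [CommRing R] :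
    Polynomial.Chebyshev.U R 3 = 8 * Polynomial.X ^ 3 - 4 * Polynomial.X := by
  rw [show (3 : ℤ) = 1 + 2 by norm_num, Polynomial.Chebyshev.U_add_two]
  norm_num [Polynomial.Chebyshev.U_two]
  ring

theorem chebyshevU_four (R : Type*) [CommRing R] :
    Polynomial.Chebyshev.U R 4 = 16 * Polynomial.X ^ 4 - 12 * Polynomial.X ^ 2 + 1 := by
  rw [show (4 : ℤ) = 2 + 2 by norm_num, Polynomial.Chebyshev.U_add_two]
  norm_num [Polynomial.Chebyshev.U_two, chebyshevU_three]
  ring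

theorem chebyshevU_five (R : Type*) [CommRing R] :
    Polynomial.Chebyshev.U R 5 =
      32 * Polynomial.X ^ 5 - 32 * Polynomial.X ^ 3 + 6 * Polynomial.X := by
  rw [show (5 : ℤ) = 3 + 2 by norm_num, Polynomial.Chebyshev.U_add_two]
  norm_num [chebyshevU_three, chebyshevU_four]
  ring

set_option maxHeartbeats 4000000 in
/-- The addition formula for the characters of `SU(2)`: the Chebyshev polynomial of the second
kind is the trace of the symmetric power. -/
theorem sum_symPowEntry_mul_symPowEntry {K : Type*} [Field K] [CharZero K] {k : ℕ} (hk : k ≤ 5)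
    (a b c d e f g h t : K) (ht : a * e + b * f + c * g + d * h = 2 * t)
    (hn : a * d - b * c = 1) (hm : e * h - f * g = 1) :
    ∑ i ∈ range (k + 1), ∑ j ∈ range (k + 1), ((k.choose i : K) / (k.choose j : K)) *
      (symPowEntry k i j a b c d * symPowEntry k i j e f g h) =
      (Polynomial.Chebyshev.U K k).eval t := by
  obtain rfl : t = (a * e + b * f + c * g + d * h) / 2 := by rw [ht]; ring
  have hnm : (a * d - b * c) * (e * h - f * g) = 1 := by rw [hn, hm, one_mul]
  interval_cases k
  · simp [symPowEntry]
  · simp [symPowEntry, sum_range_succ]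
    ring
  · simp [symPowEntry, sum_range_succ, Polynomial.Chebyshev.U_two, Nat.choose]
    linear_combination -hnm
  · simp [symPowEntry, sum_range_succ, chebyshevU_three, Nat.choose]
    linear_combination (-2) * (a * e + b * f + c * g + d * h) * hnm
  · simp [symPowEntry, sum_range_succ, chebyshevU_four, Nat.choose]
    linear_combination (-3 * (a * e + b * f + c * g + d * h) ^ 2 +
      (a * d - b * c) * (e * h - f * g) + 1) * hnm
  · simp [symPowEntry, sum_range_succ, chebyshevU_five, Nat.choose]
    linear_combination (-4 * (a * e + b * f + c * g + d * h) ^ 3 + 3 *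
      (a * e + b * f + c * g + d * h) * ((a * d - b * c) * (e * h - f * g) + 1)) * hnm

theorem star_symPowEntry {R : Type*} [CommSemiring R] [StarRing R] (k i j : ℕ) (a b c d : R) :
    star (symPowEntry k i j a b c d) = symPowEntry k i j (star a) (star b) (star c) (star d) := by
  simp only [symPowEntry, star_sum]
  refine sum_congr rfl fun s _ ↦ ?_
  split_ifs <;> simp [mul_comm]

/-- Positive definiteness of the zonal kernels on the three-dimensional sphere. -/
theorem sum_eval_chebyshevU_inner_nonneg {k : ℕ} (hk : k ≤ 5)
    (C : Finset (EuclideanSpace ℝ (Fin 4))) (hunit : ∀ x ∈ C, ‖x‖ = 1) :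
    0 ≤ ∑ x ∈ C, ∑ y ∈ C, (Polynomial.Chebyshev.U ℝ k).eval ⟪x, y⟫ := by
  let E : ℕ → ℕ → EuclideanSpace ℝ (Fin 4) → ℂ := fun i j x ↦
    symPowEntry k i j (⟨x 0, x 1⟩ : ℂ) ⟨x 2, x 3⟩ ⟨-x 2, x 3⟩ ⟨x 0, -x 1⟩
  have hnorm : ∀ x ∈ C, x 0 ^ 2 + x 1 ^ 2 + x 2 ^ 2 + x 3 ^ 2 = 1 := fun x hx ↦ by
    have := EuclideanSpace.real_norm_sq_eq x
    rw [hunit x hx, Fin.sum_univ_four] at this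
    linarith
  have hker : ∀ x ∈ C, ∀ y ∈ C, (((Polynomial.Chebyshev.U ℝ k).eval ⟪x, y⟫ : ℝ) : ℂ) =
      ∑ i ∈ range (k + 1), ∑ j ∈ range (k + 1), ((k.choose i : ℂ) / (k.choose j : ℂ)) *
        (E i j x * star (E i j y)) := by
    intro x hx y hy
    simp only [E, star_symPowEntry]
    rw [sum_symPowEntry_mul_symPowEntry hk (t := ((⟪x, y⟫ : ℝ) : ℂ))]
    · simp
    · apply Complex.ext
      · simp [PiLp.inner_apply, Fin.sum_univ_four]; ring
      · simp [PiLp.inner_apply, Fin.sum_univ_four]; ring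
    · have := hnorm x hx
      apply Complex.ext
      · simp; linarith
      · simp; ring
    · have := hnorm y hy
      apply Complex.ext
      · simp; linarith
      · simp; ring
  have hsum : ((∑ x ∈ C, ∑ y ∈ C, (Polynomial.Chebyshev.U ℝ k).eval ⟪x, y⟫ : ℝ) : ℂ) =
      ((∑ i ∈ range (k + 1), ∑ j ∈ range (k + 1), ((k.choose i : ℝ) / (k.choose j : ℝ)) *
        Complex.normSq (∑ x ∈ C, E i j x) : ℝ) : ℂ) := by
    simp only [Complex.ofReal_sum, Complex.ofReal_mul, Complex.ofReal_div, Complex.ofReal_natCast]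
    rw [sum_congr rfl fun x hx ↦ sum_congr rfl fun y hy ↦ hker x hx y hy]
    simp_rw [← Complex.mul_conj, map_sum, sum_mul_sum, mul_sum]
    rw [sum_congr rfl fun x _ ↦ sum_comm, sum_comm]
    refine sum_congr rfl fun i _ ↦ ?_
    rw [sum_congr rfl fun x _ ↦ sum_comm, sum_comm]
    rfl
  rw [Complex.ofReal_injective hsum]
  exact sum_nonneg fun i _ ↦ sum_nonneg fun j _ ↦ mul_nonneg (by positivity)
    (Complex.normSq_nonneg _)

/-- For a (24,4,π/3) spherical code, A([-1,0.05]) ≤ 15. -/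
theorem dist_distribution_A2
    (C : Finset (EuclideanSpace ℝ (Fin 4)))
    (hcard : C.card = 24)
    (hunit : ∀ x ∈ C, ‖x‖ = 1)
    (hcode : ∀ x ∈ C, ∀ y ∈ C, x ≠ y → ⟪x, y⟫ ≤ (1 : ℝ) / 2) :
     ({p : EuclideanSpace ℝ (Fin 4) × EuclideanSpace ℝ (Fin 4) |
      p.1 ∈ C ∧ p.2 ∈ C ∧ p.1 ≠ p.2 ∧
        ⟪p.1, p.2⟫ ∈ Set.Icc (-1 : ℝ) (0.05)}.ncard) ≤ 360 := by
  classical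
  let S : Finset (EuclideanSpace ℝ (Fin 4) × EuclideanSpace ℝ (Fin 4)) :=
    {p ∈ C.offDiag | ⟪p.1, p.2⟫ ∈ Set.Icc (-1 : ℝ) 0.05}
  have hS : {p : EuclideanSpace ℝ (Fin 4) × EuclideanSpace ℝ (Fin 4) |
      p.1 ∈ C ∧ p.2 ∈ C ∧ p.1 ≠ p.2 ∧ ⟪p.1, p.2⟫ ∈ Set.Icc (-1 : ℝ) (0.05)} = S := by
    ext p
    simp [S, and_assoc]
  rw [hS, Set.ncard_coe_finset]
  have heven : Even #S := by
    rw [← ZMod.natCast_eq_zero_iff_even, card_eq_sum_ones, Nat.cast_sum]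
    refine sum_involution (fun p _ ↦ p.swap) (fun _ _ ↦ by decide) ?_ ?_ (fun _ _ ↦ rfl)
    · rintro ⟨x, y⟩ hp - heq
      simp only [S, mem_filter, mem_offDiag] at hp
      exact hp.1.2.2 (congrArg Prod.snd heq)
    · rintro ⟨x, y⟩ hp
      simp only [S, mem_filter, mem_offDiag, Prod.swap_prod_mk] at hp ⊢
      rw [real_inner_comm]
      tauto
  let u : ℕ → ℝ → ℝ := fun k t ↦ (Polynomial.Chebyshev.U ℝ k).eval t
  have hu : ∀ k ≤ 5, 0 ≤ ∑ x ∈ C, ∑ y ∈ C, u k ⟪x, y⟫ :=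
    fun k hk ↦ sum_eval_chebyshevU_inner_nonneg hk C hunit
  let F : ℝ → ℝ := fun t ↦
    103 - 326 * u 1 t - 284 * u 2 t - 164 * u 3 t - 59 * u 4 t - 10 * u 5 t
  have hF : ∀ t, F t = 324 + 320 * (t + 1) ^ 2 * (t + 1 / 2) ^ 2 * (1 / 20 - t) := fun t ↦ by
    simp [F, u, Polynomial.Chebyshev.U_two, chebyshevU_three, chebyshevU_four, chebyshevU_five]
    ring
  have hsum : ∑ x ∈ C, ∑ y ∈ C, F ⟪x, y⟫ ≤ 59328 := by
    have := hu 1 (by norm_num)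
    have := hu 2 (by norm_num)
    have := hu 3 (by norm_num)
    have := hu 4 (by norm_num)
    have := hu 5 (by norm_num)
    simp only [F, sum_sub_distrib, ← mul_sum, sum_const, hcard, nsmul_eq_mul]
    push_cast
    linarith
  have hdiag : ∑ p ∈ C.diag, F ⟪p.1, p.2⟫ = -57888 := by
    rw [sum_diag, sum_congr rfl fun x hx ↦ by rw [real_inner_self_eq_norm_sq, hunit x hx, hF],
      sum_const, hcard]
    norm_num
  have hoff : ∑ p ∈ C.offDiag, F ⟪p.1, p.2⟫ ≤ 117216 := by
    rw [← sum_product', ← diag_union_offDiag, sum_union (disjoint_diag_offDiag C), hdiag] at hsum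
    linarith
  have hcount : 324 * (#S : ℝ) ≤ ∑ p ∈ C.offDiag, F ⟪p.1, p.2⟫ := by
    rw [mul_comm, ← nsmul_eq_mul, ← sum_const, sum_filter]
    refine sum_le_sum fun p hp ↦ ?_
    rw [mem_offDiag] at hp
    have hle := hcode p.1 hp.1 p.2 hp.2.1 hp.2.2
    have hge : -1 ≤ ⟪p.1, p.2⟫ := by
      have := abs_real_inner_le_norm p.1 p.2
      rw [hunit _ hp.1, hunit _ hp.2.1, one_mul] at this
      exact (abs_le.1 this).1
    generalize ⟪p.1, p.2⟫ = t at hle hge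
    rw [hF]
    split_ifs with h
    · have : (0 : ℝ) ≤ 1 / 20 - t := by linarith [h.2]
      have : 0 ≤ 320 * (t + 1) ^ 2 * (t + 1 / 2) ^ 2 * (1 / 20 - t) := by positivity
      linarith
    · have h' : 1 / 20 < t := by
        by_contra! h'
        exact h ⟨hge, by linarith⟩
      have h₁ : (t + 1) ^ 2 ≤ 9 / 4 := by nlinarith
      have h₂ : (t + 1 / 2) ^ 2 ≤ 1 := by nlinarith
      have h₃ : (t + 1) ^ 2 * (t + 1 / 2) ^ 2 ≤ 9 / 4 * 1 := by gcongr
      nlinarith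
  have hlt : (#S : ℝ) < 362 := by linarith
  have hlt' : #S < 362 := by exact_mod_cast hlt
  obtain ⟨m, hm⟩ := heven
  omega
end

section
/- Let C be a (24,4,π/3) spherical code, i.e., a set of 24 unit vectors in ℝ⁴ with x·y ≤ 1/2 for all distinct x,y ∈ C. Then A([-0.55,0.05]) ≤ 14; that is, the number of ordered pairs (x,y) of distinct points of C with x·y ∈ [-0.55,0.05] is at most 14·24 = 336. -/
open Finset RealInnerProductSpace

open Complex ComplexConjugate Polynomial.Chebyshev

/-- Powers of a complex Gram kernel are positive semidefinite. -/
lemma re_sum_gram_pow_nonneg {α ι : Type*} [Fintype ι] (s : Finset α) (φ : α → ι → ℂ) (k : ℕ) :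
    0 ≤ (∑ x ∈ s, ∑ y ∈ s, (∑ a, conj (φ x a) * φ y a) ^ k).re := by
  have h : ∑ x ∈ s, ∑ y ∈ s, (∑ a, conj (φ x a) * φ y a) ^ k =
      ∑ p : Fin k → ι, ((normSq (∑ x ∈ s, ∏ i, φ x (p i)) : ℝ) : ℂ) := by
    simp_rw [Fintype.sum_pow, normSq_eq_conj_mul_self, map_sum, map_prod, sum_mul_sum,
      ← prod_mul_distrib]
    exact (sum_congr rfl fun _ _ ↦ sum_comm).trans sum_comm
  rw [h, ← ofReal_sum, ofReal_re]
  exact sum_nonneg fun p _ ↦ normSq_nonneg _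

/-- The symplectic forms `⟪x, i y⟫`, `⟪x, j y⟫`, `⟪x, k y⟫` given by left multiplication with the
quaternion units. -/
def quaternionForm (x y : EuclideanSpace ℝ (Fin 4)) : Fin 3 → ℝ :=
  ![-x 0 * y 1 + x 1 * y 0 - x 2 * y 3 + x 3 * y 2,
    -x 0 * y 2 + x 1 * y 3 + x 2 * y 0 - x 3 * y 1,
    -x 0 * y 3 - x 1 * y 2 + x 2 * y 1 + x 3 * y 0]

lemma inner_sq_add_quaternionForm_sq (x y : EuclideanSpace ℝ (Fin 4)) :
    ⟪x, y⟫ ^ 2 + ∑ i, quaternionForm x y i ^ 2 = ‖x‖ ^ 2 * ‖y‖ ^ 2 := by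
  simp only [EuclideanSpace.real_norm_sq_eq, PiLp.inner_apply, Fin.sum_univ_succ, quaternionForm]
  simp
  ring

/-- For a unit imaginary quaternion `n`, the powers of the Hermitian form `⟪x, y⟫ + i ⟪x, n y⟫`
are positive semidefinite kernels. -/
lemma re_sum_hermitian_pow_nonneg (C : Finset (EuclideanSpace ℝ (Fin 4))) (n : Fin 3 → ℝ)
    (hn : ∑ i, n i ^ 2 = 1) (k : ℕ) :
    0 ≤ ∑ x ∈ C, ∑ y ∈ C,
      (((⟪x, y⟫ : ℝ) + (∑ i, n i * quaternionForm x y i : ℝ) * I : ℂ) ^ k).re := by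
  let φ (x : EuclideanSpace ℝ (Fin 4)) : Fin 4 → ℂ :=
    ![⟨x 0, -n 0 * x 1 - n 1 * x 2 - n 2 * x 3⟩, ⟨x 1, n 0 * x 0 + n 1 * x 3 - n 2 * x 2⟩,
      ⟨x 2, -n 0 * x 3 + n 1 * x 0 + n 2 * x 1⟩, ⟨x 3, n 0 * x 2 - n 1 * x 1 + n 2 * x 0⟩]
  have hφ (x y : EuclideanSpace ℝ (Fin 4)) :
      ((⟪x, y⟫ : ℝ) + (∑ i, n i * quaternionForm x y i : ℝ) * I : ℂ) =
        (1 / 2 : ℝ) * ∑ a, conj (φ x a) * φ y a := by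
    simp only [Fin.sum_univ_succ, quaternionForm, φ, PiLp.inner_apply] at hn ⊢
    apply Complex.ext
    · simp at hn ⊢
      linear_combination (-(x 0 * y 0 + x 1 * y 1 + x 2 * y 2 + x 3 * y 3) / 2) * hn
    · simp
      ring
  have h := re_sum_gram_pow_nonneg C φ k
  simp_rw [hφ, mul_pow, ← ofReal_pow, re_ofReal_mul, ← mul_sum, ← re_sum]
  positivity

/-- Representatives modulo sign of the nodes of McLaren's 50-point cubature rule on the sphere,
before normalization. -/
def cubatureNode : Fin 25 → Fin 3 → ℝ :=
  ![![1, 0, 0], ![0, 1, 0], ![0, 0, 1],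
    ![1, 1, 0], ![1, -1, 0], ![1, 0, 1], ![1, 0, -1], ![0, 1, 1], ![0, 1, -1],
    ![1, 1, 1], ![1, 1, -1], ![1, -1, 1], ![-1, 1, 1],
    ![1, 1, 3], ![1, 1, -3], ![1, -1, 3], ![-1, 1, 3],
    ![1, 3, 1], ![1, 3, -1], ![1, -3, 1], ![-1, 3, 1],
    ![3, 1, 1], ![3, 1, -1], ![3, -1, 1], ![-3, 1, 1]]

/-- The weights of McLaren's cubature rule. -/
noncomputable def cubatureWeight : Fin 25 → ℝ :=
  ![8 / 315, 8 / 315, 8 / 315,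
    128 / 2835, 128 / 2835, 128 / 2835, 128 / 2835, 128 / 2835, 128 / 2835,
    27 / 640, 27 / 640, 27 / 640, 27 / 640,
    14641 / 362880, 14641 / 362880, 14641 / 362880, 14641 / 362880,
    14641 / 362880, 14641 / 362880, 14641 / 362880, 14641 / 362880,
    14641 / 362880, 14641 / 362880, 14641 / 362880, 14641 / 362880]

lemma cubatureWeight_nonneg (l : Fin 25) : 0 ≤ cubatureWeight l := by
  fin_cases l <;> simp [cubatureWeight] <;> norm_num

lemma cubatureNode_sq_pos (l : Fin 25) : 0 < ∑ i, cubatureNode l i ^ 2 := by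
  fin_cases l <;> simp [cubatureNode, Fin.sum_univ_succ] <;> norm_num

/-- The even moments of the cubature rule agree with those of the sphere. -/
lemma cubature_moment (w : Fin 3 → ℝ) {j : ℕ} (hj : j < 5) :
    ∑ l, cubatureWeight l *
        ((∑ i, cubatureNode l i * w i) ^ 2 / ∑ i, cubatureNode l i ^ 2) ^ j =
      (∑ i, w i ^ 2) ^ j / (2 * j + 1) := by
  simp only [Fin.sum_univ_succ, cubatureNode, cubatureWeight]
  interval_cases j <;> simp <;> ring

lemma re_pow_eq_sum (t s : ℝ) {k : ℕ} (hk : k < 10) :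
    (((t : ℂ) + s * I) ^ k).re =
      ∑ j ∈ range 5, (k.choose (2 * j) : ℝ) * (-1) ^ j * t ^ (k - 2 * j) * (s ^ 2) ^ j := by
  have h (m : ℕ) : (((t : ℂ) + s * I) ^ (m + 2)).re =
      2 * t * (((t : ℂ) + s * I) ^ (m + 1)).re - (t ^ 2 + s ^ 2) * (((t : ℂ) + s * I) ^ m).re := by
    simp [pow_succ]
    ring
  interval_cases k <;> simp [h, sum_range_succ, Nat.choose] <;> ring

lemma chebyshevU_eval_eq_sum (t : ℝ) {k : ℕ} (hk : k < 10) :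
    ∑ j ∈ range 5, (k.choose (2 * j) : ℝ) * (-1) ^ j * t ^ (k - 2 * j) *
      ((1 - t ^ 2) ^ j / (2 * j + 1)) = (U ℝ k).eval t / (k + 1) := by
  have h (m : ℤ) : (U ℝ (m + 2)).eval t = 2 * t * (U ℝ (m + 1)).eval t - (U ℝ m).eval t := by
    simp [U_add_two]
  have h₃ := h 1
  have h₄ := h 2
  have h₅ := h 3
  have h₆ := h 4
  have h₇ := h 5
  have h₈ := h 6
  have h₉ := h 7
  norm_num at h₃ h₄ h₅ h₆ h₇ h₈ h₉
  interval_cases k <;>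
    simp [U_two, h₃, h₄, h₅, h₆, h₇, h₈, h₉, sum_range_succ, Nat.choose] <;> ring

/-- On `S³` the Chebyshev polynomials of the second kind (of degree at most nine) are positive
semidefinite functions of the inner product. -/
lemma sum_chebyshevU_inner_nonneg (C : Finset (EuclideanSpace ℝ (Fin 4)))
    (hunit : ∀ x ∈ C, ‖x‖ = 1) {k : ℕ} (hk : k < 10) :
    0 ≤ ∑ x ∈ C, ∑ y ∈ C, (U ℝ k).eval ⟪x, y⟫ := by
  let n (l : Fin 25) (i : Fin 3) : ℝ := cubatureNode l i / √(∑ i, cubatureNode l i ^ 2)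
  have hn (l : Fin 25) : ∑ i, n l i ^ 2 = 1 := by
    simp only [n, div_pow, ← sum_div]
    rw [Real.sq_sqrt (cubatureNode_sq_pos l).le, div_self (cubatureNode_sq_pos l).ne']
  have hns (l : Fin 25) (w : Fin 3 → ℝ) : (∑ i, n l i * w i) ^ 2 =
      (∑ i, cubatureNode l i * w i) ^ 2 / ∑ i, cubatureNode l i ^ 2 := by
    simp only [n, div_mul_eq_mul_div, ← sum_div, div_pow]
    rw [Real.sq_sqrt (cubatureNode_sq_pos l).le]
  have key (x) (hx : x ∈ C) (y) (hy : y ∈ C) : (U ℝ k).eval ⟪x, y⟫ =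
      (k + 1) * ∑ l, cubatureWeight l *
        (((⟪x, y⟫ : ℝ) + (∑ i, n l i * quaternionForm x y i : ℝ) * I : ℂ) ^ k).re := by
    have hw : ∑ i, quaternionForm x y i ^ 2 = 1 - ⟪x, y⟫ ^ 2 := by
      have := inner_sq_add_quaternionForm_sq x y
      rw [hunit x hx, hunit y hy] at this
      linarith
    have hk0 : (k + 1 : ℝ) ≠ 0 := by positivity
    rw [← mul_div_cancel₀ ((U ℝ k).eval ⟪x, y⟫) hk0, ← chebyshevU_eval_eq_sum _ hk]
    congr 1
    simp_rw [re_pow_eq_sum _ _ hk, hns, mul_sum]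
    rw [sum_comm]
    refine sum_congr rfl fun j hj ↦ ?_
    rw [← hw, ← cubature_moment _ (mem_range.1 hj), mul_sum]
    exact sum_congr rfl fun l _ ↦ by ring
  rw [sum_congr rfl fun x hx ↦ sum_congr rfl fun y hy ↦ key x hx y hy]
  simp_rw [← mul_sum]
  refine mul_nonneg (by positivity) ?_
  rw [(sum_congr rfl fun _ _ ↦ sum_comm).trans sum_comm]
  refine sum_nonneg fun l _ ↦ ?_
  simp_rw [← mul_sum]
  exact mul_nonneg (cubatureWeight_nonneg l) (re_sum_hermitian_pow_nonneg C (n l) (hn l) k)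

/-- The expansion `2.802 P₁ + 4.513 P₂ + 3.517 P₃ + 2.514 P₄ + 0.512 P₅ + 0.201 P₉` in normalized
Gegenbauer polynomials `Pₖ = Uₖ / (k + 1)` of a dual linear programming certificate. -/
noncomputable def certificate (t : ℝ) : ℝ :=
  6432 / 625 * t ^ 9 - 12864 / 625 * t ^ 7 + 30446 / 1875 * t ^ 5 + 5028 / 625 * t ^ 4 +
    1631 / 1500 * t ^ 3 - 61 / 3750 * t ^ 2 - 1 / 500 * t - 15023 / 15000

lemma certificate_le_left {t : ℝ} (h₁ : -1 ≤ t) (h₂ : t ≤ -49 / 50) :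
    certificate t ≤ -77 / 100000 := by
  obtain ⟨u, hu⟩ : ∃ u, u = t + 1 := ⟨_, rfl⟩
  obtain ⟨v, hv⟩ : ∃ v, v = -49 / 50 - t := ⟨_, rfl⟩
  have hu0 : 0 ≤ u := by linarith
  have hv0 : 0 ≤ v := by linarith
  have key : -77 / 100000 - certificate t = 16 / 1875 * (
      968170166015625 * v ^ 9 + 4837799072265625 * u * v ^ 8 +
      8942346191406250 * u ^ 2 * v ^ 7 + 7960137451171875 * u ^ 3 * v ^ 6 +
      8922645449218750 * u ^ 4 * v ^ 5 + 21536142994140625 * u ^ 5 * v ^ 4 +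
      32729214462656250 * u ^ 6 * v ^ 3 + 25980200017880625 * u ^ 7 * v ^ 2 +
      10457363829975825 * u ^ 8 * v + 1705460563812744 * u ^ 9) := by
    subst hu hv
    simp only [certificate]
    ring
  have : 0 ≤ -77 / 100000 - certificate t := by rw [key]; positivity
  linarith

lemma certificate_le_middle {t : ℝ} (h₁ : -49 / 50 ≤ t) (h₂ : t ≤ 9 / 25) :
    certificate t ≤ -77 / 100000 := by
  obtain ⟨u, hu⟩ : ∃ u, u = t + 49 / 50 := ⟨_, rfl⟩
  obtain ⟨v, hv⟩ : ∃ v, v = 9 / 25 - t := ⟨_, rfl⟩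
  have hu0 : 0 ≤ u := by linarith
  have hv0 : 0 ≤ v := by linarith
  have key : -77 / 100000 - certificate t = 16 / 51012251993053025625 * (
      1705460563812744 * v ^ 9 + 343098488445019053 * u * v ^ 8 +
      19372908299831873241 * u ^ 2 * v ^ 7 + 1235709399155712222 * u ^ 3 * v ^ 6 +
      36975111301860641569 * u ^ 4 * v ^ 5 + 32318562745936882842 * u ^ 5 * v ^ 4 +
      16273054261203771179 * u ^ 6 * v ^ 3 + 8175478528519715638 * u ^ 7 * v ^ 2 +
      2429295844258728921 * u ^ 8 * v + 168145523729791817 * u ^ 9) := by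
    subst hu hv
    simp only [certificate]
    ring
  have : 0 ≤ -77 / 100000 - certificate t := by rw [key]; positivity
  linarith

lemma certificate_le_right {t : ℝ} (h₁ : 9 / 25 ≤ t) (h₂ : t ≤ 1 / 2) :
    certificate t ≤ -77 / 100000 := by
  obtain ⟨u, hu⟩ : ∃ u, u = t - 9 / 25 := ⟨_, rfl⟩
  obtain ⟨v, hv⟩ : ∃ v, v = 1 / 2 - t := ⟨_, rfl⟩
  have hu0 : 0 ≤ u := by linarith
  have hv0 : 0 ≤ v := by linarith
  have key : -77 / 100000 - certificate t = 16 / 75663013125 * (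
      168145523729791817 * v ^ 9 + 1417609670063138025 * u * v ^ 8 +
      5230815868853983750 * u ^ 2 * v ^ 7 + 11032106241132703125 * u ^ 3 * v ^ 6 +
      14544298279202343750 * u ^ 4 * v ^ 5 + 12272333848154296875 * u ^ 5 * v ^ 4 +
      6471859423339843750 * u ^ 6 * v ^ 3 + 1950259075927734375 * u ^ 7 * v ^ 2 +
      257276763916015625 * u ^ 8 * v + 86975097656250 * u ^ 9) := by
    subst hu hv
    simp only [certificate]
    ring
  have : 0 ≤ -77 / 100000 - certificate t := by rw [key]; positivity
  linarith

lemma certificate_le_sub_one_left {t : ℝ} (h₁ : -11 / 20 ≤ t) (h₂ : t ≤ -1 / 5) :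
    certificate t ≤ -77 / 100000 - 1 := by
  obtain ⟨u, hu⟩ : ∃ u, u = t + 11 / 20 := ⟨_, rfl⟩
  obtain ⟨v, hv⟩ : ∃ v, v = -1 / 5 - t := ⟨_, rfl⟩
  have hu0 : 0 ≤ u := by linarith
  have hv0 : 0 ≤ v := by linarith
  have key : -77 / 100000 - 1 - certificate t = 32 / 75663013125 * (
      18212997273 * v ^ 9 + 1575351388748 * u * v ^ 8 +
      5007609233888 * u ^ 2 * v ^ 7 + 4670169849408 * u ^ 3 * v ^ 6 +
      689842584368 * u ^ 4 * v ^ 5 + 30352525952 * u ^ 5 * v ^ 4 +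
      1611433649952 * u ^ 6 * v ^ 3 + 1437789923712 * u ^ 7 * v ^ 2 +
      464265998592 * u ^ 8 * v + 53367551232 * u ^ 9) := by
    subst hu hv
    simp only [certificate]
    ring
  have : 0 ≤ -77 / 100000 - 1 - certificate t := by rw [key]; positivity
  linarith

lemma certificate_le_sub_one_right {t : ℝ} (h₁ : -1 / 5 ≤ t) (h₂ : t ≤ 1 / 20) :
    certificate t ≤ -77 / 100000 - 1 := by
  obtain ⟨u, hu⟩ : ∃ u, u = t + 1 / 5 := ⟨_, rfl⟩
  obtain ⟨v, hv⟩ : ∃ v, v = 1 / 20 - t := ⟨_, rfl⟩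
  have hu0 : 0 ≤ u := by linarith
  have hv0 : 0 ≤ v := by linarith
  have key : -77 / 100000 - 1 - certificate t = 32 / 3662109375 * (
      53367551232 * v ^ 9 + 491766505728 * u * v ^ 8 +
      1831723558272 * u ^ 2 * v ^ 7 + 3512343727008 * u ^ 3 * v ^ 6 +
      3755871423872 * u ^ 4 * v ^ 5 + 2475200658032 * u ^ 5 * v ^ 4 +
      1374290411328 * u ^ 6 * v ^ 3 + 773742527072 * u ^ 7 * v ^ 2 +
      260360559308 * u ^ 8 * v + 21382351797 * u ^ 9) := by
    subst hu hv
    simp only [certificate]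
    ring
  have : 0 ≤ -77 / 100000 - 1 - certificate t := by rw [key]; positivity
  linarith

lemma certificate_le {t : ℝ} (h₁ : -1 ≤ t) (h₂ : t ≤ 1 / 2) : certificate t ≤ -77 / 100000 := by
  rcases le_total t (-49 / 50) with h | h
  · exact certificate_le_left h₁ (by linarith)
  rcases le_total t (9 / 25) with h' | h'
  · exact certificate_le_middle (by linarith) h'
  · exact certificate_le_right h' h₂

lemma certificate_le_sub_one {t : ℝ} (ht : t ∈ Set.Icc (-0.55 : ℝ) 0.05) :
    certificate t ≤ -77 / 100000 - 1 := by
  obtain ⟨h₁, h₂⟩ := ht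
  norm_num at h₁ h₂
  rcases le_total t (-1 / 5) with h | h
  · exact certificate_le_sub_one_left (by linarith) (by linarith)
  · exact certificate_le_sub_one_right (by linarith) h₂

lemma sum_certificate_inner_nonneg (C : Finset (EuclideanSpace ℝ (Fin 4)))
    (hunit : ∀ x ∈ C, ‖x‖ = 1) : 0 ≤ ∑ x ∈ C, ∑ y ∈ C, certificate ⟪x, y⟫ := by
  have h (t : ℝ) : certificate t = 2.802 / 2 * (U ℝ (1 : ℕ)).eval t +
      4.513 / 3 * (U ℝ (2 : ℕ)).eval t + 3.517 / 4 * (U ℝ (3 : ℕ)).eval t +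
      2.514 / 5 * (U ℝ (4 : ℕ)).eval t + 0.512 / 6 * (U ℝ (5 : ℕ)).eval t +
      0.201 / 10 * (U ℝ (9 : ℕ)).eval t := by
    have hU (k : ℕ) (hk : k < 10) :=
      (div_eq_iff (by positivity)).1 (chebyshevU_eval_eq_sum t hk).symm
    rw [hU 1, hU 2, hU 3, hU 4, hU 5, hU 9] <;> norm_num [certificate, sum_range_succ, Nat.choose]
    ring
  have hU {k : ℕ} (hk : k < 10) := sum_chebyshevU_inner_nonneg C hunit hk
  simp_rw [h, sum_add_distrib, ← mul_sum]
  have h₁ := hU (k := 1) (by norm_num)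
  have h₂ := hU (k := 2) (by norm_num)
  have h₃ := hU (k := 3) (by norm_num)
  have h₄ := hU (k := 4) (by norm_num)
  have h₅ := hU (k := 5) (by norm_num)
  have h₉ := hU (k := 9) (by norm_num)
  positivity

/-- For a (24,4,π/3) spherical code, A([-0.55,0.05]) ≤ 14. -/
theorem dist_distribution_A3
    (C : Finset (EuclideanSpace ℝ (Fin 4)))
    (hcard : C.card = 24)
    (hunit : ∀ x ∈ C, ‖x‖ = 1)
    (hcode : ∀ x ∈ C, ∀ y ∈ C, x ≠ y → ⟪x, y⟫ ≤ (1 : ℝ) / 2) :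
     ({p : EuclideanSpace ℝ (Fin 4) × EuclideanSpace ℝ (Fin 4) |
      p.1 ∈ C ∧ p.2 ∈ C ∧ p.1 ≠ p.2 ∧
        ⟪p.1, p.2⟫ ∈ Set.Icc (-0.55 : ℝ) (0.05)}.ncard) ≤ 336 := by
  classical
  set S := C.offDiag.filter fun p ↦ ⟪p.1, p.2⟫ ∈ Set.Icc (-0.55 : ℝ) 0.05 with hS
  have hset : {p : EuclideanSpace ℝ (Fin 4) × EuclideanSpace ℝ (Fin 4) |
      p.1 ∈ C ∧ p.2 ∈ C ∧ p.1 ≠ p.2 ∧ ⟪p.1, p.2⟫ ∈ Set.Icc (-0.55 : ℝ) (0.05)} = S := by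
    ext p
    simp [hS, and_assoc]
  rw [hset, Set.ncard_coe_finset]
  have hoff : ∑ p ∈ C.offDiag, certificate ⟪p.1, p.2⟫ ≤ 552 * (-77 / 100000) - S.card := by
    calc ∑ p ∈ C.offDiag, certificate ⟪p.1, p.2⟫
        ≤ ∑ p ∈ C.offDiag, (-77 / 100000 -
            if ⟪p.1, p.2⟫ ∈ Set.Icc (-0.55 : ℝ) 0.05 then 1 else 0) := by
          refine sum_le_sum fun p hp ↦ ?_
          obtain ⟨hx, hy, hne⟩ := mem_offDiag.1 hp
          split_ifs with h
          · exact certificate_le_sub_one h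
          · have := neg_le_of_abs_le (abs_real_inner_le_norm p.1 p.2)
            rw [hunit _ hx, hunit _ hy, one_mul] at this
            simpa using certificate_le this (hcode _ hx _ hy hne)
      _ = 552 * (-77 / 100000) - S.card := by
          rw [sum_sub_distrib, sum_boole, sum_const, offDiag_card, hcard]
          norm_num [hS]
  have hdiag : ∑ p ∈ C.diag, certificate ⟪p.1, p.2⟫ = 24 * certificate 1 := by
    rw [sum_diag, sum_congr rfl fun x hx ↦ by rw [real_inner_self_eq_norm_sq, hunit x hx, one_pow],
      sum_const, hcard]
    norm_num
  have htotal := sum_certificate_inner_nonneg C hunit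
  rw [← sum_product', ← diag_union_offDiag, sum_union (disjoint_diag_offDiag C), hdiag] at htotal
  have hone : certificate 1 = 14.059 := by norm_num [certificate]
  have : (S.card : ℝ) < 337 := by rw [hone] at htotal; linarith
  exact Nat.lt_succ_iff.1 (by exact_mod_cast this)
end
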